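/- For every positive integer k, in any prime kth-power distance labeling of the complete graph K₄, the four vertex labels cannot all have the same parity; that is, there is no prime kth-power distance labeling of K₄ in which all four labels are congruent modulo 2. -/

import Mathlib

/-- `L` is a prime `k`th-power distance labeling of `G`: `L` is injective and for
every edge the absolute difference of labels is `p ^ j` for some prime `p` and some
positive integer `j ≤ k`. -/
def IsPrimePowerLabeling {V : Type*} (G : SimpleGraph V) (k : ℕ) (L : V → ℤ) : Prop :=
  Function.Injective L ∧
  ∀ u v : V, G.Adj u v → ∃ p j : ℕ, p.Prime ∧ 1 ≤ j ∧ j ≤ k ∧ |L u - L v| = (p : ℤ) ^ j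

/-- Two powers of two whose sum is a power of two are equal. -/
theorem two_pow_eq_of_add_eq_two_pow {x y z : ℕ} (h : (2 : ℤ) ^ x + 2 ^ y = 2 ^ z) :
    (2 : ℤ) ^ x = 2 ^ y := by
  have hx : (0 : ℤ) < 2 ^ x := by positivity
  have hy : (0 : ℤ) < 2 ^ y := by positivity
  have hxz : x < z := (pow_lt_pow_iff_right₀ (one_lt_two (α := ℤ))).1 (by linarith)
  have hyz : y < z := (pow_lt_pow_iff_right₀ (one_lt_two (α := ℤ))).1 (by linarith)
  have h₁ : (2 : ℤ) ^ (x + 1) ≤ 2 ^ z := pow_le_pow_right₀ one_le_two hxz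
  have h₂ : (2 : ℤ) ^ (y + 1) ≤ 2 ^ z := pow_le_pow_right₀ one_le_two hyz
  rw [pow_succ] at h₁ h₂
  linarith

/-- If all pairwise distances of three integers are powers of two, then one of the integers is
the midpoint of the other two. -/
theorem exists_midpoint_of_abs_sub_eq_two_pow {a b c : ℤ} {x y z : ℕ} (hab : |a - b| = 2 ^ x)
    (hbc : |b - c| = 2 ^ y) (hac : |a - c| = 2 ^ z) :
    a + b = 2 * c ∨ a + c = 2 * b ∨ b + c = 2 * a := by
  have hx : (0 : ℤ) < 2 ^ x := by positivity
  have hy : (0 : ℤ) < 2 ^ y := by positivity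
  have hz : (0 : ℤ) < 2 ^ z := by positivity
  have h₁ := @two_pow_eq_of_add_eq_two_pow x y z
  have h₂ := @two_pow_eq_of_add_eq_two_pow y z x
  have h₃ := @two_pow_eq_of_add_eq_two_pow x z y
  rw [← hab, ← hbc, ← hac] at h₁ h₂ h₃
  rw [← hab] at hx
  rw [← hbc] at hy
  rw [← hac] at hz
  clear hab hbc hac
  rcases abs_cases (a - b) with ⟨h, _⟩ | ⟨h, _⟩ <;>
  rcases abs_cases (b - c) with ⟨h', _⟩ | ⟨h', _⟩ <;>
  rcases abs_cases (a - c) with ⟨h'', _⟩ | ⟨h'', _⟩ <;>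
  rw [h, h', h''] at h₁ h₂ h₃ <;> omega

/-- In a prime power labeling, adjacent labels of the same parity differ by a power of two. -/
theorem IsPrimePowerLabeling.abs_sub_eq_two_pow {V : Type*} {G : SimpleGraph V} {k : ℕ}
    {L : V → ℤ} (hL : IsPrimePowerLabeling G k L) {u v : V} (huv : G.Adj u v)
    (hpar : L u % 2 = L v % 2) : ∃ j : ℕ, |L u - L v| = 2 ^ j := by
  obtain ⟨p, j, hp, -, -, h⟩ := hL.2 u v huv
  have hdvd : (2 : ℤ) ∣ (p : ℤ) ^ j := by
    rw [← h, dvd_abs]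
    omega
  have hp2 : 2 ∣ p := by exact_mod_cast Int.prime_two.dvd_of_dvd_pow hdvd
  obtain rfl := (Nat.prime_dvd_prime_iff_eq Nat.prime_two hp).1 hp2
  exact ⟨j, by exact_mod_cast h⟩

/-- In any prime `k`th-power distance labeling of `K₄`, the four vertex labels
cannot all have the same parity. -/
theorem K4_labels_not_same_parity (k : ℕ) (hk : 0 < k) :
    ¬ ∃ L : Fin 4 → ℤ, IsPrimePowerLabeling (⊤ : SimpleGraph (Fin 4)) k L ∧
      ∀ u v : Fin 4, L u % 2 = L v % 2 := by
  rintro ⟨L, hL, hpar⟩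
  have hne (u v : Fin 4) (huv : u ≠ v) : L u ≠ L v := hL.1.ne huv
  have hpow (u v : Fin 4) (huv : u ≠ v) : ∃ j : ℕ, |L u - L v| = 2 ^ j :=
    hL.abs_sub_eq_two_pow ((SimpleGraph.top_adj u v).2 huv) (hpar u v)
  have hmid (u v w : Fin 4) (huv : u ≠ v) (hvw : v ≠ w) (huw : u ≠ w) :
      L u + L v = 2 * L w ∨ L u + L w = 2 * L v ∨ L v + L w = 2 * L u := by
    obtain ⟨x, hx⟩ := hpow u v huv
    obtain ⟨y, hy⟩ := hpow v w hvw
    obtain ⟨z, hz⟩ := hpow u w huw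
    exact exists_midpoint_of_abs_sub_eq_two_pow hx hy hz
  have h01 := hne 0 1 (by decide)
  have h02 := hne 0 2 (by decide)
  have h03 := hne 0 3 (by decide)
  have h12 := hne 1 2 (by decide)
  have h13 := hne 1 3 (by decide)
  have h23 := hne 2 3 (by decide)
  rcases hmid 0 1 2 (by decide) (by decide) (by decide) with h₀ | h₀ | h₀ <;>
  rcases hmid 0 1 3 (by decide) (by decide) (by decide) with h₀₁ | h₀₁ | h₀₁ <;>
  rcases hmid 0 2 3 (by decide) (by decide) (by decide) with h₀₂ | h₀₂ | h₀₂ <;>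
  rcases hmid 1 2 3 (by decide) (by decide) (by decide) with h₀₃ | h₀₃ | h₀₃ <;>
  omega
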